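/- arXiv:2109.10705 — 2 statements merged into one kernel-verified Lean document; each statement's English description precedes it below -/
import Mathlib

section
/- There exists a set of 14 points in the plane in general position that contains a 3-crossing family but no 4-crossing family, i.e., a set S of 14 points with cf(S) = 3. -/
/-- A finite set of points in the plane is in *general position* if no three of
its points are collinear. -/
def GenPos (S : Finset (ℝ × ℝ)) : Prop :=
  ∀ p ∈ S, ∀ q ∈ S, ∀ r ∈ S, p ≠ q → p ≠ r → q ≠ r →
    ¬Collinear ℝ ({p, q, r} : Set (ℝ × ℝ))

/-- Two closed segments `pq` and `rs` *cross* if they intersect in exactly one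
point, which lies in the interior of both segments. -/
def Crosses (p q r s : ℝ × ℝ) : Prop :=
  ∃ x : ℝ × ℝ, x ∈ openSegment ℝ p q ∧ x ∈ openSegment ℝ r s ∧
    segment ℝ p q ∩ segment ℝ r s = {x}

/-- `F` is a *crossing family* in `S`: a finite set of segments (given by their
pairs of distinct endpoints, which belong to `S`) that pairwise cross. -/
def IsCrossingFamily (S : Finset (ℝ × ℝ)) (F : Finset ((ℝ × ℝ) × (ℝ × ℝ))) : Prop :=
  (∀ e ∈ F, e.1 ∈ S ∧ e.2 ∈ S ∧ e.1 ≠ e.2) ∧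
  (∀ e ∈ F, ∀ f ∈ F, e ≠ f → Crosses e.1 e.2 f.1 f.2)

/-- `S` contains a `k`-crossing family. -/
def HasCrossingFamily (S : Finset (ℝ × ℝ)) (k : ℕ) : Prop :=
  ∃ F : Finset ((ℝ × ℝ) × (ℝ × ℝ)), IsCrossingFamily S F ∧ F.card = k

/-- `cf S`: the maximum size of a crossing family in `S`. -/
noncomputable def cf (S : Finset (ℝ × ℝ)) : ℕ :=
  sSup {k : ℕ | HasCrossingFamily S k}

/-- `cfNat n`: the minimum of `cf S` over all sets `S` of `n` points in
general position. -/
noncomputable def cfNat (n : ℕ) : ℕ :=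
  sInf {m : ℕ | ∃ S : Finset (ℝ × ℝ), S.card = n ∧ GenPos S ∧ cf S = m}

namespace CrossingFamily

/-- Twice the signed area of the triangle `a b c`. -/
def orient {R : Type*} [CommRing R] (a b c : R × R) : R :=
  (b.1 - a.1) * (c.2 - a.2) - (b.2 - a.2) * (c.1 - a.1)

theorem orient_eq_zero_of_collinear {p q r : ℝ × ℝ}
    (h : Collinear ℝ ({p, q, r} : Set (ℝ × ℝ))) : orient p q r = 0 := by
  obtain ⟨v, hv⟩ := (collinear_iff_of_mem (p₀ := p) (by simp)).1 h
  obtain ⟨b, hb⟩ := hv q (by simp)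
  obtain ⟨c, hc⟩ := hv r (by simp)
  subst hb hc
  simp only [orient, vadd_eq_add, Prod.fst_add, Prod.snd_add, Prod.smul_fst, Prod.smul_snd,
    smul_eq_mul]
  ring

theorem orient_combo (r s p q : ℝ × ℝ) {a b : ℝ} (hab : a + b = 1) :
    orient r s (a • p + b • q) = a * orient r s p + b * orient r s q := by
  obtain rfl : b = 1 - a := by linarith
  simp only [orient, Prod.fst_add, Prod.snd_add, Prod.smul_fst, Prod.smul_snd, smul_eq_mul]
  ring

theorem orient_eq_zero_of_mem_segment {p q x : ℝ × ℝ} (h : x ∈ segment ℝ p q) :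
    orient p q x = 0 := by
  obtain ⟨a, b, -, -, hab, rfl⟩ := h
  rw [orient_combo _ _ _ _ hab]
  simp only [orient]
  ring

theorem _root_.Crosses.symm {p q r s : ℝ × ℝ} (h : Crosses p q r s) : Crosses r s p q := by
  obtain ⟨x, h₁, h₂, h₃⟩ := h
  exact ⟨x, h₂, h₁, by rw [Set.inter_comm, h₃]⟩

/-- The segment `pq` is not contained in a segment that it crosses. -/
theorem _root_.Crosses.endpoints_not_mem {p q r s : ℝ × ℝ} (h : Crosses p q r s) (hpq : p ≠ q) :
    ¬(p ∈ segment ℝ r s ∧ q ∈ segment ℝ r s) := by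
  rintro ⟨hp, hq⟩
  obtain ⟨x, -, -, hx⟩ := h
  have h₁ : p ∈ segment ℝ p q ∩ segment ℝ r s := ⟨left_mem_segment ℝ p q, hp⟩
  have h₂ : q ∈ segment ℝ p q ∩ segment ℝ r s := ⟨right_mem_segment ℝ p q, hq⟩
  rw [hx] at h₁ h₂
  exact hpq (h₁.trans h₂.symm)

/-- If `pq` crosses `rs`, and the line `rs` meets `{p, q}` at most in `{r, s}`, then that line
strictly separates `p` from `q`. -/
theorem _root_.Crosses.orient_mul_neg {p q r s : ℝ × ℝ} (h : Crosses p q r s) (hpq : p ≠ q)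
    (hp : orient r s p = 0 → p = r ∨ p = s) (hq : orient r s q = 0 → q = r ∨ q = s) :
    orient r s p * orient r s q < 0 := by
  have hends := h.endpoints_not_mem hpq
  obtain ⟨x, ⟨a, b, ha, hb, hab, rfl⟩, hx, -⟩ := h
  have h0 := orient_eq_zero_of_mem_segment (openSegment_subset_segment ℝ _ _ hx)
  rw [orient_combo _ _ _ _ hab] at h0
  have hmem : ∀ y, y = r ∨ y = s → y ∈ segment ℝ r s := by
    rintro y (rfl | rfl)
    exacts [left_mem_segment ℝ _ _, right_mem_segment ℝ _ _]
  rcases eq_or_ne (orient r s p) 0 with hp0 | hp0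
  · rw [hp0, mul_zero, zero_add] at h0
    have hq0 : orient r s q = 0 := (mul_eq_zero.1 h0).resolve_left hb.ne'
    exact absurd ⟨hmem p (hp hp0), hmem q (hq hq0)⟩ hends
  · have hsq : 0 < orient r s p ^ 2 := by positivity
    have : b * (orient r s p * orient r s q) = -(a * orient r s p ^ 2) := by
      linear_combination orient r s p * h0
    have hneg : b * (orient r s p * orient r s q) < 0 := by
      rw [this]
      exact neg_neg_of_pos (mul_pos ha hsq)
    exact neg_of_mul_neg_right hneg hb.le

theorem orient_sub_ne_zero {p q r s : ℝ × ℝ} (h : orient r s p * orient r s q < 0) :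
    orient r s p - orient r s q ≠ 0 := by
  intro h0
  rw [sub_eq_zero.1 h0] at h
  exact h.not_ge (mul_self_nonneg _)

theorem orient_div_mem_openSegment {p q r s : ℝ × ℝ} (h : orient r s p * orient r s q < 0) :
    (-orient r s q / (orient r s p - orient r s q)) • p +
      (orient r s p / (orient r s p - orient r s q)) • q ∈ openSegment ℝ p q := by
  refine ⟨_, _, ?_, ?_, ?_, rfl⟩
  · rcases mul_neg_iff.1 h with ⟨h₁, h₂⟩ | ⟨h₁, h₂⟩
    · exact div_pos (by linarith) (by linarith)
    · exact div_pos_of_neg_of_neg (by linarith) (by linarith)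
  · rcases mul_neg_iff.1 h with ⟨h₁, h₂⟩ | ⟨h₁, h₂⟩
    · exact div_pos (by linarith) (by linarith)
    · exact div_pos_of_neg_of_neg (by linarith) (by linarith)
  · have := orient_sub_ne_zero h
    field_simp
    ring

theorem crosses_of_orient {p q r s : ℝ × ℝ} (h₁ : orient r s p * orient r s q < 0)
    (h₂ : orient p q r * orient p q s < 0) : Crosses p q r s := by
  have hd := orient_sub_ne_zero h₁
  have hd' := orient_sub_ne_zero h₂
  have hx := orient_div_mem_openSegment h₁
  have hy := orient_div_mem_openSegment h₂
  have unique : ∀ y z : ℝ × ℝ, orient p q y = 0 → orient r s y = 0 → orient p q z = 0 →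
      orient r s z = 0 → y = z := by
    intro y z h₁ h₂ h₃ h₄
    simp only [orient] at h₁ h₂ h₃ h₄ hd
    ext <;> apply mul_left_cancel₀ hd
    · linear_combination (s.1 - r.1) * (h₁ - h₃) - (q.1 - p.1) * (h₂ - h₄)
    · linear_combination (s.2 - r.2) * (h₁ - h₃) - (q.2 - p.2) * (h₂ - h₄)
  have hxy := unique _ _ (orient_eq_zero_of_mem_segment (openSegment_subset_segment ℝ _ _ hx))
    (by
      rw [orient_combo _ _ _ _ (by field_simp; ring)]
      field_simp
      ring)
    (by
      rw [orient_combo _ _ _ _ (by field_simp; ring)]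
      field_simp
      ring)
    (orient_eq_zero_of_mem_segment (openSegment_subset_segment ℝ _ _ hy))
  rw [← hxy] at hy
  refine ⟨_, hx, hy, Set.eq_singleton_iff_unique_mem.2
    ⟨⟨openSegment_subset_segment ℝ _ _ hx, openSegment_subset_segment ℝ _ _ hy⟩, ?_⟩⟩
  rintro z ⟨hz₁, hz₂⟩
  exact unique _ _ (orient_eq_zero_of_mem_segment hz₁) (orient_eq_zero_of_mem_segment hz₂)
    (orient_eq_zero_of_mem_segment (openSegment_subset_segment ℝ _ _ hx))
    (orient_eq_zero_of_mem_segment (openSegment_subset_segment ℝ _ _ hy))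

theorem hasCrossingFamily_mono {S : Finset (ℝ × ℝ)} {k l : ℕ} (hkl : k ≤ l)
    (h : HasCrossingFamily S l) : HasCrossingFamily S k := by
  obtain ⟨F, ⟨h₁, h₂⟩, hF⟩ := h
  obtain ⟨G, hGF, hG⟩ := Finset.exists_subset_card_eq (hF ▸ hkl)
  exact ⟨G, ⟨fun e he => h₁ e (hGF he), fun e he f hf => h₂ e (hGF he) f (hGF hf)⟩, hG⟩

theorem cf_eq_of_hasCrossingFamily {S : Finset (ℝ × ℝ)} {k : ℕ} (h : HasCrossingFamily S k)
    (h' : ¬HasCrossingFamily S (k + 1)) : cf S = k :=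
  IsGreatest.csSup_eq ⟨h, fun _ hl => not_lt.1 fun hlt => h' (hasCrossingFamily_mono hlt hl)⟩

/-- The pairs of entries of a list, the earlier entry first. -/
def pairs {α : Type*} : List α → List (α × α)
  | [] => []
  | a :: l => l.map (fun b => (a, b)) ++ pairs l

theorem mem_pairs {α : Type*} {l : List α} {a b : α} (ha : a ∈ l) (hb : b ∈ l) (hab : a ≠ b) :
    (a, b) ∈ pairs l ∨ (b, a) ∈ pairs l := by
  induction l with
  | nil => simp at ha
  | cons c l ih =>
    simp only [pairs, List.mem_append, List.mem_map, Prod.mk.injEq]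
    rcases List.mem_cons.1 ha with rfl | ha' <;> rcases List.mem_cons.1 hb with rfl | hb'
    · exact absurd rfl hab
    · exact Or.inl (Or.inl ⟨b, hb', rfl, rfl⟩)
    · exact Or.inr (Or.inl ⟨a, ha', rfl, rfl⟩)
    · exact (ih ha' hb').imp Or.inr Or.inr

/-- Decidable crossing test for segments with integer endpoints: each segment's line strictly
separates the endpoints of the other segment. -/
def crossesInt (e f : (ℤ × ℤ) × (ℤ × ℤ)) : Bool :=
  decide (orient f.1 f.2 e.1 * orient f.1 f.2 e.2 < 0) &&
    decide (orient e.1 e.2 f.1 * orient e.1 e.2 f.2 < 0)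

theorem crossesInt_swap_left (e f : (ℤ × ℤ) × (ℤ × ℤ)) :
    crossesInt e.swap f = crossesInt e f := by
  have h₁ : orient f.1 f.2 e.2 * orient f.1 f.2 e.1 =
      orient f.1 f.2 e.1 * orient f.1 f.2 e.2 := mul_comm _ _
  have h₂ : orient e.2 e.1 f.1 * orient e.2 e.1 f.2 =
      orient e.1 e.2 f.1 * orient e.1 e.2 f.2 := by
    simp only [orient]
    ring
  simp only [crossesInt, Prod.fst_swap, Prod.snd_swap, h₁, h₂]

theorem crossesInt_comm (e f : (ℤ × ℤ) × (ℤ × ℤ)) : crossesInt e f = crossesInt f e := by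
  simp only [crossesInt, Bool.and_comm]

theorem crossesInt_swap_right (e f : (ℤ × ℤ) × (ℤ × ℤ)) :
    crossesInt e f.swap = crossesInt e f := by
  rw [crossesInt_comm, crossesInt_swap_left, crossesInt_comm]

/-- No four members of `l` cross pairwise. -/
def noFourCrossing (l : List ((ℤ × ℤ) × (ℤ × ℤ))) : Bool :=
  l.all fun e =>
    let l₁ := l.filter (crossesInt e)
    l₁.all fun f =>
      let l₂ := l₁.filter (crossesInt f)
      l₂.all fun g => l₂.all fun h => !crossesInt g h

theorem noFourCrossing_spec {l : List ((ℤ × ℤ) × (ℤ × ℤ))} (hl : noFourCrossing l = true)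
    {e f g h : (ℤ × ℤ) × (ℤ × ℤ)} (he : e ∈ l) (hf : f ∈ l) (hg : g ∈ l) (hh : h ∈ l)
    (hef : crossesInt e f = true) (heg : crossesInt e g = true) (heh : crossesInt e h = true)
    (hfg : crossesInt f g = true) (hfh : crossesInt f h = true)
    (hgh : crossesInt g h = true) : False := by
  simp only [noFourCrossing, List.all_eq_true, List.mem_filter, Bool.not_eq_true', and_imp] at hl
  have := hl e he f hf hef g hg heg hfg h hh heh hfh
  simp [this] at hgh

/-- The inclusion of the integer lattice in the plane. -/
def toPlane (p : ℤ × ℤ) : ℝ × ℝ := (p.1, p.2)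

theorem toPlane_injective : Function.Injective toPlane := by
  rintro ⟨a, b⟩ ⟨c, d⟩ h
  simpa [toPlane] using h

theorem orient_toPlane (a b c : ℤ × ℤ) :
    orient (toPlane a) (toPlane b) (toPlane c) = ((orient a b c : ℤ) : ℝ) := by
  simp [orient, toPlane]

theorem crosses_of_crossesInt {e f : (ℤ × ℤ) × (ℤ × ℤ)} (h : crossesInt e f = true) :
    Crosses (toPlane e.1) (toPlane e.2) (toPlane f.1) (toPlane f.2) := by
  simp only [crossesInt, Bool.and_eq_true, decide_eq_true_eq] at h
  apply crosses_of_orient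
  · simp only [orient_toPlane]
    exact_mod_cast h.1
  · simp only [orient_toPlane]
    exact_mod_cast h.2

/-- No three distinct entries of `l` are collinear. -/
def IntGenPos (l : List (ℤ × ℤ)) : Prop :=
  ∀ p ∈ l, ∀ q ∈ l, p ≠ q → ∀ r ∈ l, orient p q r = 0 → r = p ∨ r = q

instance (l : List (ℤ × ℤ)) : Decidable (IntGenPos l) := by
  unfold IntGenPos
  infer_instance

theorem IntGenPos.crossesInt {l : List (ℤ × ℤ)} (hl : IntGenPos l) {p q r s : ℤ × ℤ}
    (hp : p ∈ l) (hq : q ∈ l) (hr : r ∈ l) (hs : s ∈ l) (hpq : p ≠ q) (hrs : r ≠ s)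
    (h : Crosses (toPlane p) (toPlane q) (toPlane r) (toPlane s)) :
    crossesInt (p, q) (r, s) = true := by
  have key : ∀ a ∈ l, ∀ b ∈ l, a ≠ b → ∀ c ∈ l,
      orient (toPlane a) (toPlane b) (toPlane c) = 0 →
        toPlane c = toPlane a ∨ toPlane c = toPlane b := by
    intro a ha b hb hab c hc h0
    rw [orient_toPlane] at h0
    exact (hl a ha b hb hab c hc (by exact_mod_cast h0)).imp (congrArg _) (congrArg _)
  have h₁ := h.orient_mul_neg (toPlane_injective.ne hpq) (key r hr s hs hrs p hp)
    (key r hr s hs hrs q hq)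
  have h₂ := h.symm.orient_mul_neg (toPlane_injective.ne hrs) (key p hp q hq hpq r hr)
    (key p hp q hq hpq s hs)
  simp only [orient_toPlane] at h₁ h₂
  simp only [CrossingFamily.crossesInt, Bool.and_eq_true, decide_eq_true_eq]
  exact ⟨by exact_mod_cast h₁, by exact_mod_cast h₂⟩

/-- The set of points of the plane listed by `l`. -/
noncomputable def planeSet (l : List (ℤ × ℤ)) : Finset (ℝ × ℝ) :=
  l.toFinset.map ⟨toPlane, toPlane_injective⟩

theorem mem_planeSet {l : List (ℤ × ℤ)} {x : ℝ × ℝ} :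
    x ∈ planeSet l ↔ ∃ p ∈ l, toPlane p = x := by
  simp [planeSet]

theorem IntGenPos.genPos {l : List (ℤ × ℤ)} (hl : IntGenPos l) : GenPos (planeSet l) := by
  intro p hp q hq r hr hpq hpr hqr hcol
  obtain ⟨p, hp', rfl⟩ := mem_planeSet.1 hp
  obtain ⟨q, hq', rfl⟩ := mem_planeSet.1 hq
  obtain ⟨r, hr', rfl⟩ := mem_planeSet.1 hr
  have h0 := orient_eq_zero_of_collinear hcol
  rw [orient_toPlane] at h0
  rcases hl p hp' q hq' (fun h => hpq (congrArg _ h)) r hr' (by exact_mod_cast h0) with rfl | rfl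
  · exact hpr rfl
  · exact hqr rfl

theorem IntGenPos.not_hasCrossingFamily_four {l : List (ℤ × ℤ)} (hl : IntGenPos l)
    (hc : noFourCrossing (pairs l) = true) : ¬HasCrossingFamily (planeSet l) 4 := by
  rintro ⟨F, ⟨hF, hcross⟩, hcard⟩
  have lift : ∀ e ∈ F, ∃ e' ∈ pairs l, ∀ p ∈ l, ∀ q ∈ l, e = (toPlane p, toPlane q) →
      ∀ f, CrossingFamily.crossesInt e' f = CrossingFamily.crossesInt (p, q) f := by
    rintro ⟨x, y⟩ he
    obtain ⟨hx, hy, hne⟩ := hF _ he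
    obtain ⟨p, hp, rfl⟩ := mem_planeSet.1 hx
    obtain ⟨q, hq, rfl⟩ := mem_planeSet.1 hy
    have inj : ∀ p' q', (toPlane p, toPlane q) = (toPlane p', toPlane q') → p = p' ∧ q = q' :=
      fun p' q' h => ⟨toPlane_injective (Prod.mk.inj h).1, toPlane_injective (Prod.mk.inj h).2⟩
    rcases mem_pairs hp hq (fun h => hne (congrArg toPlane h)) with h | h
    · refine ⟨_, h, fun p' _ q' _ h' f => ?_⟩
      obtain ⟨rfl, rfl⟩ := inj _ _ h'
      rfl
    · refine ⟨_, h, fun p' _ q' _ h' f => ?_⟩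
      obtain ⟨rfl, rfl⟩ := inj _ _ h'
      exact crossesInt_swap_left (p, q) f
  choose! φ hφ hφ' using lift
  have main : ∀ e ∈ F, ∀ f ∈ F, e ≠ f → CrossingFamily.crossesInt (φ e) (φ f) = true := by
    rintro ⟨x, y⟩ he ⟨z, w⟩ hf hne
    have hxy := hF _ he
    have hzw := hF _ hf
    obtain ⟨p, hp, rfl⟩ := mem_planeSet.1 hxy.1
    obtain ⟨q, hq, rfl⟩ := mem_planeSet.1 hxy.2.1
    obtain ⟨r, hr, rfl⟩ := mem_planeSet.1 hzw.1
    obtain ⟨s, hs, rfl⟩ := mem_planeSet.1 hzw.2.1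
    rw [hφ' _ he p hp q hq rfl, crossesInt_comm, hφ' _ hf r hr s hs rfl, crossesInt_comm]
    exact hl.crossesInt hp hq hr hs (fun h => hxy.2.2 (congrArg toPlane h))
      (fun h => hzw.2.2 (congrArg toPlane h)) (hcross _ he _ hf hne)
  obtain ⟨a, T, haT, rfl, hT⟩ := Finset.card_eq_succ.1 hcard
  obtain ⟨b, c, d, hbc, hbd, hcd, rfl⟩ := Finset.card_eq_three.1 hT
  simp only [Finset.mem_insert, Finset.mem_singleton, not_or] at haT
  obtain ⟨hab, hac, had⟩ := haT
  exact noFourCrossing_spec hc (hφ a (by simp)) (hφ b (by simp)) (hφ c (by simp)) (hφ d (by simp))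
    (main a (by simp) b (by simp) hab) (main a (by simp) c (by simp) hac)
    (main a (by simp) d (by simp) had) (main b (by simp) c (by simp) hbc)
    (main b (by simp) d (by simp) hbd) (main c (by simp) d (by simp) hcd)

theorem hasCrossingFamily_three {l : List (ℤ × ℤ)} {a b c d e f : ℤ × ℤ}
    (hmem : ∀ p ∈ [a, b, c, d, e, f], p ∈ l) (hnodup : [a, b, c, d, e, f].Nodup)
    (h₁ : crossesInt (a, b) (c, d) = true) (h₂ : crossesInt (a, b) (e, f) = true)
    (h₃ : crossesInt (c, d) (e, f) = true) : HasCrossingFamily (planeSet l) 3 := by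
  simp only [List.mem_cons, List.not_mem_nil, or_false, forall_eq_or_imp, forall_eq] at hmem
  obtain ⟨ha, hb, hc, hd, he, hf⟩ := hmem
  simp only [List.nodup_cons, List.mem_cons, List.not_mem_nil, or_false, not_or] at hnodup
  obtain ⟨⟨hab, hac, -, hae, -⟩, -, ⟨hcd, hce, -⟩, -, ⟨hef, -⟩⟩ := hnodup
  have mem : ∀ p ∈ l, toPlane p ∈ planeSet l := fun p hp => mem_planeSet.2 ⟨p, hp, rfl⟩
  have ne : ∀ {p q : ℤ × ℤ}, p ≠ q → toPlane p ≠ toPlane q := toPlane_injective.ne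
  have x₁ := crosses_of_crossesInt h₁
  have x₂ := crosses_of_crossesInt h₂
  have x₃ := crosses_of_crossesInt h₃
  refine ⟨{(toPlane a, toPlane b), (toPlane c, toPlane d), (toPlane e, toPlane f)},
    ⟨?_, ?_⟩, ?_⟩
  · simp only [Finset.mem_insert, Finset.mem_singleton, forall_eq_or_imp, forall_eq]
    exact ⟨⟨mem a ha, mem b hb, ne hab⟩, ⟨mem c hc, mem d hd, ne hcd⟩,
      ⟨mem e he, mem f hf, ne hef⟩⟩
  · simp only [Finset.mem_insert, Finset.mem_singleton]
    rintro _ (rfl | rfl | rfl) _ (rfl | rfl | rfl) hne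
    exacts [absurd rfl hne, x₁, x₂, x₁.symm, absurd rfl hne, x₃, x₂.symm, x₃.symm, absurd rfl hne]
  · refine Finset.card_eq_three.2 ⟨_, _, _, ?_, ?_, ?_, rfl⟩
    · exact fun h => ne hac (congrArg Prod.fst h)
    · exact fun h => ne hae (congrArg Prod.fst h)
    · exact fun h => ne hce (congrArg Prod.fst h)

/-- Fourteen points in general position without four pairwise crossing segments. -/
def fourteenPoints : List (ℤ × ℤ) :=
  [(54, 496), (81, 0), (29, 437), (52, 1316), (43, 731), (53, 1235), (39, 541), (55, 1530),
    (0, 24), (43, 802), (74, 141), (58, 341), (41, 717), (21, 477)]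

theorem intGenPos_fourteenPoints : IntGenPos fourteenPoints := by
  decide +kernel

theorem noFourCrossing_fourteenPoints : noFourCrossing (pairs fourteenPoints) = true := by
  decide +kernel

theorem hasCrossingFamily_three_fourteenPoints :
    HasCrossingFamily (planeSet fourteenPoints) 3 :=
  hasCrossingFamily_three (a := (54, 496)) (b := (81, 0)) (c := (55, 1530)) (d := (58, 341))
    (e := (74, 141)) (f := (41, 717)) (by decide) (by decide) (by decide +kernel)
    (by decide +kernel) (by decide +kernel)

theorem card_planeSet_fourteenPoints : (planeSet fourteenPoints).card = 14 := by
  rw [planeSet, Finset.card_map]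
  decide +kernel

end CrossingFamily

open CrossingFamily in
/-- There exists a set of 14 points in the plane in general position containing
a 3-crossing family but no 4-crossing family, i.e. with `cf S = 3`. -/
theorem exists_14_points_without_4_crossing_family :
    ∃ S : Finset (ℝ × ℝ), S.card = 14 ∧ GenPos S ∧
      HasCrossingFamily S 3 ∧ ¬ HasCrossingFamily S 4 ∧ cf S = 3 := by
  have h₃ := hasCrossingFamily_three_fourteenPoints
  have h₄ := intGenPos_fourteenPoints.not_hasCrossingFamily_four noFourCrossing_fourteenPoints
  exact ⟨planeSet fourteenPoints, card_planeSet_fourteenPoints, intGenPos_fourteenPoints.genPos,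
    h₃, h₄, cf_eq_of_hasCrossingFamily h₃ h₄⟩
end

section
/- A geometric thrackle contains no even cycle: if T is a geometric graph in which every two edges either share an endpoint or cross properly, then the underlying abstract graph of T contains no cycle of even length. -/
/-- Twice the signed area of the triangle `abp`; its sign tells on which side of the
line `ab` the point `p` lies. -/
def signedArea (a b p : ℝ × ℝ) : ℝ :=
  (b.1 - a.1) * (p.2 - a.2) - (b.2 - a.2) * (p.1 - a.1)

theorem collinear_of_signedArea_eq_zero {a b c : ℝ × ℝ} (hab : a ≠ b)
    (h : signedArea a b c = 0) : Collinear ℝ ({a, b, c} : Set (ℝ × ℝ)) := by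
  unfold signedArea at h
  rw [collinear_iff_of_mem (p₀ := a) (by simp)]
  refine ⟨b - a, fun p hp => ?_⟩
  simp only [Set.mem_insert_iff, Set.mem_singleton_iff] at hp
  rcases hp with rfl | rfl | rfl
  · exact ⟨0, by simp⟩
  · exact ⟨1, by simp⟩
  · by_cases h1 : b.1 - a.1 = 0
    · have h2 : b.2 - a.2 ≠ 0 := fun h2 =>
        hab (Prod.ext (by linarith) (by linarith))
      refine ⟨(p.2 - a.2) / (b.2 - a.2), Prod.ext ?_ ?_⟩
      · have : p.1 - a.1 = 0 := by
          have h3 : (b.2 - a.2) * (p.1 - a.1) = 0 := by rw [h1] at h; linarith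
          exact (mul_eq_zero.mp h3).resolve_left h2
        simp [h1]
        linarith
      · simp
        field_simp
        ring
    · refine ⟨(p.1 - a.1) / (b.1 - a.1), Prod.ext ?_ ?_⟩
      · simp
        field_simp
        ring
      · simp
        field_simp
        linarith

theorem signedArea_eq_of_mem_openSegment {a b c d x : ℝ × ℝ}
    (hx : x ∈ openSegment ℝ c d) :
    ∃ s t : ℝ, 0 < s ∧ 0 < t ∧
      signedArea a b x = s * signedArea a b c + t * signedArea a b d := by
  obtain ⟨s, t, hs, ht, hst, rfl⟩ := hx
  refine ⟨s, t, hs, ht, ?_⟩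
  obtain rfl : s = 1 - t := by linarith
  simp [signedArea]
  ring

theorem signedArea_left (a b : ℝ × ℝ) : signedArea a b a = 0 := by
  simp [signedArea]

theorem signedArea_right (a b : ℝ × ℝ) : signedArea a b b = 0 := by
  simp [signedArea]
  ring

/-- The endpoints of a segment crossing `ab` lie on opposite sides of the line `ab`. -/
theorem Crosses.signedArea_mul_neg {a b c d : ℝ × ℝ} (h : Crosses a b c d)
    (hc : signedArea a b c ≠ 0) : signedArea a b c * signedArea a b d < 0 := by
  obtain ⟨x, hab, hcd, -⟩ := h
  obtain ⟨s, t, -, -, h₁⟩ := signedArea_eq_of_mem_openSegment (a := a) (b := b) hab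
  obtain ⟨u, v, hu, hv, h₂⟩ := signedArea_eq_of_mem_openSegment (a := a) (b := b) hcd
  rw [signedArea_left, signedArea_right] at h₁
  have h₃ : v * (signedArea a b c * signedArea a b d) = -(u * signedArea a b c ^ 2) := by
    linear_combination signedArea a b c * (h₁ - h₂)
  have h₄ : 0 < u * signedArea a b c ^ 2 := by positivity
  by_contra! h₅
  nlinarith [mul_nonneg hv.le h₅]

/-- If `ca` and `bd` cross, then `c` and `d` do not lie on opposite sides of the line `ab`. -/
theorem Crosses.signedArea_mul_nonneg {a b c d : ℝ × ℝ} (h : Crosses c a b d) :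
    0 ≤ signedArea a b c * signedArea a b d := by
  obtain ⟨x, hca, hbd, -⟩ := h
  obtain ⟨s, t, hs, -, h₁⟩ := signedArea_eq_of_mem_openSegment (a := a) (b := b) hca
  obtain ⟨u, v, -, hv, h₂⟩ := signedArea_eq_of_mem_openSegment (a := a) (b := b) hbd
  rw [signedArea_left] at h₁
  rw [signedArea_right] at h₂
  have h₃ : (s * v) * (signedArea a b c * signedArea a b d) = signedArea a b x ^ 2 := by
    have h₄ : s * signedArea a b c = signedArea a b x := by linarith
    have h₅ : v * signedArea a b d = signedArea a b x := by linarith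
    rw [mul_mul_mul_comm, h₄, h₅, sq]
  exact nonneg_of_mul_nonneg_right (h₃ ▸ sq_nonneg _) (mul_pos hs hv)

/-- A geometric thrackle contains no even cycle: if `G` is a graph drawn in the
plane with vertices at distinct points (no three collinear) and straight-line
edges such that every two edges with no common endpoint cross properly, then
`G` contains no cycle of even length. -/
theorem geometric_thrackle_no_even_cycle {V : Type*} (G : SimpleGraph V)
    (pos : V → ℝ × ℝ) (hinj : Function.Injective pos)
    (hgp : ∀ a b c : V, a ≠ b → a ≠ c → b ≠ c →
      ¬Collinear ℝ ({pos a, pos b, pos c} : Set (ℝ × ℝ)))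
    (hthrackle : ∀ a b c d : V, G.Adj a b → G.Adj c d →
      a ≠ c → a ≠ d → b ≠ c → b ≠ d → Crosses (pos a) (pos b) (pos c) (pos d))
    (v : V) (w : G.Walk v v) (hw : w.IsCycle) :
    ¬ Even w.length := by
  intro heven
  have hlen := hw.three_le_length
  have hne : ∀ i j, i < w.length → j < w.length → i ≠ j → w.getVert i ≠ w.getVert j :=
    fun i j hi hj hij h => hij (hw.getVert_injOn' (by simp; omega) (by simp; omega) h)
  have hadj : ∀ i, i < w.length → G.Adj (w.getVert i) (w.getVert (i + 1)) :=
    fun i hi => w.adj_getVert_succ hi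
  set o : ℕ → ℝ := fun i => signedArea (pos (w.getVert 0)) (pos (w.getVert 1)) (pos (w.getVert i))
  have ho_ne : ∀ i, 2 ≤ i → i < w.length → o i ≠ 0 := fun i h2 hi h =>
    hgp _ _ _ (hne 0 1 (by omega) (by omega) (by omega)) (hne 0 i (by omega) hi (by omega))
      (hne 1 i (by omega) hi (by omega))
      (collinear_of_signedArea_eq_zero
        (hinj.ne (hne 0 1 (by omega) (by omega) (by omega))) h)
  have halt : ∀ i, 2 ≤ i → i + 1 < w.length → o i * o (i + 1) < 0 := fun i h2 hi =>
    (hthrackle _ _ _ _ (hadj 0 (by omega)) (hadj i (by omega))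
      (hne _ _ (by omega) (by omega) (by omega)) (hne _ _ (by omega) (by omega) (by omega))
      (hne _ _ (by omega) (by omega) (by omega))
      (hne _ _ (by omega) (by omega) (by omega))).signedArea_mul_neg (ho_ne i h2 (by omega))
  have hodd : ∀ k, 2 * k + 3 < w.length → o (2 * k + 3) * o 2 < 0 := by
    intro k
    induction k with
    | zero =>
      intro hk
      rw [mul_comm]
      exact halt 2 le_rfl hk
    | succ k ih =>
      intro hk
      have h₁ := ih (by omega)
      have h₂ := halt (2 * k + 3) (by omega) (by omega)
      have h₃ := halt (2 * k + 3 + 1) (by omega) (by omega)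
      change o (2 * k + 3 + 1 + 1) * o 2 < 0
      by_contra! h₄
      have h₅ := mul_pos_of_neg_of_neg h₂ h₃
      have h₆ := mul_nonpos_of_nonpos_of_nonneg h₁.le h₄
      have h₇ : 0 < o (2 * k + 3 + 1) ^ 2 := by
        have := ho_ne (2 * k + 3 + 1) (by omega) (by omega)
        positivity
      have h₈ : 0 < o (2 * k + 3) * o (2 * k + 3 + 1 + 1) :=
        pos_of_mul_pos_right (a := o (2 * k + 3 + 1) ^ 2) (by linarith) h₇.le
      have h₉ : 0 < o 2 ^ 2 := by
        have := ho_ne 2 le_rfl (by omega)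
        positivity
      nlinarith [mul_pos h₈ h₉]
  obtain ⟨m, hm⟩ := heven
  obtain ⟨k, rfl⟩ : ∃ k, m = k + 2 := ⟨m - 2, by omega⟩
  have hclose : G.Adj (w.getVert (2 * k + 3)) (w.getVert 0) := by
    have h := hadj (2 * k + 3) (by omega)
    rw [w.getVert_zero]
    rwa [show 2 * k + 3 + 1 = w.length by omega, w.getVert_length] at h
  exact (hodd k (by omega)).not_ge
    (hthrackle _ _ _ _ hclose (hadj 1 (by omega))
      (hne _ _ (by omega) (by omega) (by omega)) (hne _ _ (by omega) (by omega) (by omega))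
      (hne _ _ (by omega) (by omega) (by omega))
      (hne _ _ (by omega) (by omega) (by omega))).signedArea_mul_nonneg
end
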